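/- Let α, β be locally integrable complex-valued functions on ℝ, and set f = −β e^{Pα} and g = e^{−Pα}, where Pu(x) = ∫_0^x u. Then for any y_0, y_1 ∈ ℂ, the function y = y_0 C_{f,g} + y_1 S_{g,f} is locally absolutely continuous with locally absolutely continuous derivative, satisfies y(0) = y_0, y′(0) = y_1, and satisfies y″ + α y′ + β y = 0 almost everywhere. -/

import Mathlib

open MeasureTheory intervalIntegral Filter

noncomputable section

/-- Alternating product f(s1)g(s2)f(s3)⋯ with j factors (index 0 ↦ f). -/
def altProd (f g : ℝ → ℂ) (j : ℕ) (s : Fin j → ℝ) : ℂ :=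
  ∏ i : Fin j, if (i : ℕ) % 2 = 0 then f (s i) else g (s i)

/-- The signed simplex integral A_j(f,g,x). -/
def simplexA (f g : ℝ → ℂ) (j : ℕ) (x : ℝ) : ℂ :=
  if 0 ≤ x then
    ∫ s in {s : Fin j → ℝ | StrictMono s ∧ ∀ i, s i ∈ Set.Ioo 0 x}, altProd f g j s
  else
    (-1 : ℂ) ^ j *
      ∫ s in {s : Fin j → ℝ | StrictAnti s ∧ ∀ i, s i ∈ Set.Ioo x 0}, altProd f g j s

/-- The bivariate exponential E_{f,g}. -/
def bivE (f g : ℝ → ℂ) (x : ℝ) : ℂ := 1 + ∑' j : ℕ, simplexA f g (j + 1) x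

def bivC (f g : ℝ → ℂ) (x : ℝ) : ℂ := (bivE f g x + bivE (-f) (-g) x) / 2

def bivS (f g : ℝ → ℂ) (x : ℝ) : ℂ := (bivE f g x - bivE (-f) (-g) x) / 2

/-- Locally absolutely continuous complex-valued function on ℝ. -/
def LocAC (F : ℝ → ℂ) : Prop :=
  ∃ F' : ℝ → ℂ, LocallyIntegrable F' volume ∧
    ∀ x : ℝ, F x = F 0 + ∫ t in (0:ℝ)..x, F' t

end

theorem AbsolutelyContinuousOnInterval.of_dist_le {X Y : Type*} [PseudoMetricSpace X]
    [PseudoMetricSpace Y] {f : ℝ → X} {F : ℝ → Y} {a b K : ℝ}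
    (hf : AbsolutelyContinuousOnInterval f a b) (hK : 0 ≤ K)
    (h : ∀ x ∈ Set.uIcc a b, ∀ y ∈ Set.uIcc a b, dist (F x) (F y) ≤ K * dist (f x) (f y)) :
    AbsolutelyContinuousOnInterval F a b := by
  rw [absolutelyContinuousOnInterval_iff] at hf ⊢
  intro ε hε
  obtain ⟨δ, hδ, H⟩ := hf (ε / (K + 1)) (by positivity)
  refine ⟨δ, hδ, fun E hE hlt ↦ ?_⟩
  calc _ ≤ ∑ i ∈ Finset.range E.1, K * dist (f (E.2 i).1) (f (E.2 i).2) :=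
        Finset.sum_le_sum fun i hi ↦ h _ (hE.1 i hi).1 _ (hE.1 i hi).2
    _ = K * ∑ i ∈ Finset.range E.1, dist (f (E.2 i).1) (f (E.2 i).2) :=
        (Finset.mul_sum _ _ _).symm
    _ ≤ K * (ε / (K + 1)) := by gcongr; exact (H E hE hlt).le
    _ < (K + 1) * (ε / (K + 1)) := by gcongr; linarith
    _ = ε := by field

theorem MeasureTheory.LocallyIntegrable.intervalIntegrable' {E : Type*} [NormedAddCommGroup E]
    {f : ℝ → E} (hf : LocallyIntegrable f volume) (a b : ℝ) :
    IntervalIntegrable f volume a b :=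
  intervalIntegrable_iff.mpr <|
    (hf.integrableOn_isCompact isCompact_uIcc).mono_set Set.uIoc_subset_uIcc

section
variable {E : Type*} [NormedAddCommGroup E] [NormedSpace ℝ E]

theorem absolutelyContinuousOnInterval_primitive {f : ℝ → E}
    (hf : LocallyIntegrable f volume) (a b c : ℝ) :
    AbsolutelyContinuousOnInterval (fun x ↦ ∫ t in c..x, f t) a b := by
  have hi := hf.intervalIntegrable'
  have hn : ∀ u v, IntervalIntegrable (fun t ↦ ‖f t‖) volume u v := fun u v ↦ (hi u v).norm
  refine ((hn a b).absolutelyContinuousOnInterval_intervalIntegral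
    Set.left_mem_uIcc).of_dist_le zero_le_one fun x _ y _ ↦ ?_
  rw [dist_eq_norm, dist_eq_norm, integral_interval_sub_left (hi _ _) (hi _ _),
    integral_interval_sub_left (hn _ _) (hn _ _), one_mul]
  exact norm_integral_le_abs_integral_norm

theorem AbsolutelyContinuousOnInterval.comp_contDiff {G : Type*} [NormedAddCommGroup G]
    [NormedSpace ℝ G] [ProperSpace E]
    {f : ℝ → E} {a b : ℝ} (hf : AbsolutelyContinuousOnInterval f a b) {φ : E → G}
    (hφ : ContDiff ℝ 1 φ) : AbsolutelyContinuousOnInterval (fun x ↦ φ (f x)) a b := by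
  obtain ⟨C, hC⟩ := hf.exists_bound
  obtain ⟨K, hK⟩ := hφ.contDiffOn.exists_lipschitzOnWith (by decide)
    (convex_closedBall (0 : E) C) (isCompact_closedBall _ _)
  exact hf.of_dist_le K.2 fun x hx y hy ↦
    hK.dist_le_mul _ (by simpa using hC x hx) _ (by simpa using hC y hy)

theorem eq_add_integral_of_ae_hasDerivAt [CompleteSpace E] {F d : ℝ → E}
    (hF : ∀ a b, AbsolutelyContinuousOnInterval F a b) (hd : LocallyIntegrable d volume)
    (h : ∀ᵐ x, HasDerivAt F (d x) x) (x : ℝ) : F x = F 0 + ∫ t in (0 : ℝ)..x, d t := by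
  have hG := (hF 0 x).sub (absolutelyContinuousOnInterval_primitive hd 0 x 0)
  obtain ⟨C, hC⟩ := hG.const_of_ae_hasDerivAt_zero (by
    filter_upwards [h, LocallyIntegrable.ae_hasDerivAt_integral hd] with t h₁ h₂ _
    simpa using h₁.sub (h₂ 0))
  have h0 := hC 0 Set.left_mem_uIcc
  have hx := hC x Set.right_mem_uIcc
  simp only [Pi.sub_apply, integral_same, sub_zero] at h0 hx
  rw [h0, ← hx]; abel

theorem MeasureTheory.LocallyIntegrable.continuous_primitive
    {f : ℝ → E} (hf : LocallyIntegrable f volume) (a : ℝ) :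
    Continuous fun x ↦ ∫ t in a..x, f t :=
  intervalIntegral.continuous_primitive hf.intervalIntegrable' a

end

theorem integral_mul_primitive_pow {φ : ℝ → ℝ} (hφ : LocallyIntegrable φ volume) (n : ℕ) (x : ℝ) :
    ∫ t in (0 : ℝ)..x, φ t * ((∫ u in (0 : ℝ)..t, φ u) ^ n / n.factorial) =
      (∫ u in (0 : ℝ)..x, φ u) ^ (n + 1) / (n + 1).factorial := by
  have hc := hφ.continuous_primitive 0
  have hd : LocallyIntegrable
      (fun t ↦ φ t * ((∫ u in (0 : ℝ)..t, φ u) ^ n / n.factorial)) volume := by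
    exact hφ.mul_continuous (by fun_prop)
  have := eq_add_integral_of_ae_hasDerivAt
    (F := fun x ↦ (∫ u in (0 : ℝ)..x, φ u) ^ (n + 1) / (n + 1).factorial)
    (fun a b ↦ (absolutelyContinuousOnInterval_primitive hφ a b 0).comp_contDiff
      (φ := fun y ↦ y ^ (n + 1) / (n + 1).factorial) (by fun_prop)) hd ?_ x
  · simpa using this.symm
  · filter_upwards [LocallyIntegrable.ae_hasDerivAt_integral hφ] with t ht
    refine (((ht 0).pow (n + 1)).div_const ((n + 1).factorial : ℝ)).congr_deriv ?_
    rw [Nat.factorial_succ]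
    push_cast
    have : (n : ℝ) + 1 ≠ 0 := by positivity
    field_simp

theorem simplexA_zero (f g : ℝ → ℂ) (x : ℝ) : simplexA f g 0 x = 1 := by
  simp [simplexA, altProd, Subsingleton.strictMono, Subsingleton.strictAnti, Measure.real, volume_pi,
    Measure.pi_empty_univ]

theorem simplexA_neg (f g : ℝ → ℂ) (j : ℕ) (x : ℝ) :
    simplexA (-f) (-g) j x = (-1) ^ j * simplexA f g j x := by
  have h : altProd (-f) (-g) j = fun s ↦ (-1) ^ j * altProd f g j s := by
    funext s
    simp only [altProd, Pi.neg_apply, ← neg_ite, Finset.prod_neg, Finset.card_univ,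
      Fintype.card_fin]
  unfold simplexA
  split_ifs
  · rw [h, MeasureTheory.integral_const_mul]
  · rw [h, MeasureTheory.integral_const_mul]

theorem simplexA_comp_neg (f g : ℝ → ℂ) (j : ℕ) {x : ℝ} (hx : 0 < x) :
    simplexA f g j (-x) = simplexA (fun t ↦ -f (-t)) (fun t ↦ -g (-t)) j x := by
  change _ = simplexA (-(fun t ↦ f (-t))) (-(fun t ↦ g (-t))) j x
  rw [simplexA_neg]
  unfold simplexA
  rw [if_neg (by linarith), if_pos hx.le]
  congr 1
  have := (MeasurePreserving.setIntegral_preimage_emb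
    (Measure.measurePreserving_neg (volume : Measure (Fin j → ℝ)))
    (MeasurableEquiv.neg (Fin j → ℝ)).measurableEmbedding (altProd f g j)
    {s | StrictAnti s ∧ ∀ i, s i ∈ Set.Ioo (-x) 0})
  rw [← this]
  congr 2
  ext s
  simp [StrictAnti, StrictMono, and_comm]

theorem measurableSet_strictMono_Ioo (j : ℕ) (x : ℝ) :
    MeasurableSet {s : Fin j → ℝ | StrictMono s ∧ ∀ i, s i ∈ Set.Ioo 0 x} := by
  unfold StrictMono
  measurability

theorem integrableOn_altProd {f g : ℝ → ℂ} (hf : LocallyIntegrable f volume)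
    (hg : LocallyIntegrable g volume) (j : ℕ) (x : ℝ) :
    IntegrableOn (altProd f g j) {s : Fin j → ℝ | StrictMono s ∧ ∀ i, s i ∈ Set.Ioo 0 x} := by
  have hI : ∀ {h : ℝ → ℂ}, LocallyIntegrable h volume → IntegrableOn h (Set.Ioo 0 x) := fun hh ↦
    (hh.integrableOn_isCompact isCompact_Icc).mono_set Set.Ioo_subset_Icc_self
  have : IntegrableOn (altProd f g j) (Set.univ.pi fun _ ↦ Set.Ioo 0 x) := by
    rw [IntegrableOn, volume_pi, Measure.restrict_pi_pi]
    have := Integrable.fintype_prod (ι := Fin j) (μ := fun _ ↦ volume.restrict (Set.Ioo 0 x))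
      (f := fun i ↦ if (i : ℕ) % 2 = 0 then f else g)
      (fun i ↦ by split_ifs; exacts [hI hf, hI hg])
    refine this.congr (.of_forall fun s ↦ ?_)
    simp only [altProd]
    refine Finset.prod_congr rfl fun i _ ↦ ?_
    split_ifs <;> rfl
  exact this.mono_set fun s hs i _ ↦ hs.2 i

theorem simplexA_succ_of_nonneg {f g : ℝ → ℂ} (hf : LocallyIntegrable f volume)
    (hg : LocallyIntegrable g volume) (j : ℕ) {x : ℝ} (hx : 0 ≤ x) :
    simplexA f g (j + 1) x =
      ∫ t in (0 : ℝ)..x, (if j % 2 = 0 then f t else g t) * simplexA f g j t := by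
  set S := {s : Fin (j + 1) → ℝ | StrictMono s ∧ ∀ i, s i ∈ Set.Ioo 0 x}
  have hS : MeasurableSet S := measurableSet_strictMono_Ioo _ _
  let e : ℝ × (Fin j → ℝ) ≃ᵐ (Fin (j + 1) → ℝ) :=
    (MeasurableEquiv.piFinSuccAbove (fun _ ↦ ℝ) (Fin.last j)).symm
  have hem : MeasurePreserving e :=
    (volume_preserving_piFinSuccAbove (fun _ : Fin (j + 1) ↦ ℝ) (Fin.last j)).symm _
  have hpre : ∀ t s, e (t, s) ∈ S ↔ t ∈ Set.Ioo 0 x ∧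
      s ∈ {s : Fin j → ℝ | StrictMono s ∧ ∀ i, s i ∈ Set.Ioo 0 t} := by
    intro t s
    change StrictMono (Fin.insertNth (α := fun _ ↦ ℝ) (Fin.last j) t s) ∧
      (∀ i, Fin.insertNth (α := fun _ ↦ ℝ) (Fin.last j) t s i ∈ Set.Ioo 0 x) ↔ _
    rw [Fin.strictMono_insertNth_iff, Fin.forall_iff_succAbove (Fin.last j)]
    simp only [Fin.insertNth_apply_same, Fin.insertNth_apply_succAbove, Set.mem_Ioo,
      Fin.castSucc_lt_last, Set.mem_ofPred_eq, true_imp_iff]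
    constructor
    · rintro ⟨⟨h1, h2, -⟩, h3, h4⟩
      exact ⟨h3, h1, fun i ↦ ⟨(h4 i).1, h2 i⟩⟩
    · rintro ⟨h1, h2, h3⟩
      refine ⟨⟨h2, fun i ↦ (h3 i).2, fun i hi ↦ ?_⟩, h1, fun i ↦ ⟨(h3 i).1, (h3 i).2.trans h1.2⟩⟩
      exact absurd hi (Fin.castSucc_lt_last i).not_ge
  have hprod : ∀ t s, altProd f g (j + 1) (e (t, s)) =
      (if j % 2 = 0 then f t else g t) * altProd f g j s := by
    intro t s
    change altProd f g (j + 1) (Fin.insertNth (α := fun _ ↦ ℝ) (Fin.last j) t s) = _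
    rw [altProd, Fin.prod_univ_succAbove _ (Fin.last j)]
    simp only [Fin.insertNth_apply_same, Fin.insertNth_apply_succAbove]
    simp [altProd]
  have hint : Integrable (fun p ↦ S.indicator (altProd f g (j + 1)) (e p))
      ((volume : Measure ℝ).prod (volume : Measure (Fin j → ℝ))) :=
    (hem.integrable_comp_emb e.measurableEmbedding).2
      ((integrable_indicator_iff hS).2 (integrableOn_altProd hf hg (j + 1) x))
  rw [simplexA, if_pos hx, ← MeasureTheory.integral_indicator hS,
    ← hem.integral_comp e.measurableEmbedding, Measure.volume_eq_prod, integral_prod _ hint,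
    integral_of_le hx, integral_Ioc_eq_integral_Ioo, ← MeasureTheory.integral_indicator measurableSet_Ioo]
  congr 1
  funext t
  by_cases ht : t ∈ Set.Ioo 0 x
  · rw [Set.indicator_of_mem ht, simplexA, if_pos ht.1.le, ← MeasureTheory.integral_const_mul,
      ← MeasureTheory.integral_indicator (measurableSet_strictMono_Ioo _ _)]
    congr 1
    funext s
    simp only [Set.indicator, hpre, ht, true_and, hprod]
  · rw [Set.indicator_of_notMem ht]
    simp [Set.indicator, hpre, ht]

theorem simplexA_succ {f g : ℝ → ℂ} (hf : LocallyIntegrable f volume)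
    (hg : LocallyIntegrable g volume) (j : ℕ) (x : ℝ) :
    simplexA f g (j + 1) x =
      ∫ t in (0 : ℝ)..x, (if j % 2 = 0 then f t else g t) * simplexA f g j t := by
  rcases le_or_gt 0 x with hx | hx
  · exact simplexA_succ_of_nonneg hf hg j hx
  have hneg : ∀ {h : ℝ → ℂ}, LocallyIntegrable h volume →
      LocallyIntegrable (fun t ↦ -h (-t)) volume := by
    intro h hh
    rw [locallyIntegrable_iff] at hh ⊢
    intro K hK
    have := ((Measure.measurePreserving_neg (volume : Measure ℝ)).integrableOn_comp_preimage
      (MeasurableEquiv.neg ℝ).measurableEmbedding).2 (hh (-K) hK.neg)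
    simpa [Function.comp_def] using this.neg
  rw [← neg_neg x, simplexA_comp_neg f g _ (by linarith),
    simplexA_succ_of_nonneg (hneg hf) (hneg hg) j (by linarith)]
  have : ∫ t in (0 : ℝ)..-x, (fun u ↦ (if j % 2 = 0 then f u else g u) * simplexA f g j u) (-t) =
      ∫ t in x..0, (if j % 2 = 0 then f t else g t) * simplexA f g j t := by
    rw [intervalIntegral.integral_comp_neg
      (fun u ↦ (if j % 2 = 0 then f u else g u) * simplexA f g j u)]
    simp
  rw [neg_neg, integral_symm x 0, ← this, ← intervalIntegral.integral_neg]
  refine integral_congr_ae (.of_forall fun t ht ↦ ?_)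
  rw [Set.uIoc_of_le (by linarith)] at ht
  simp only [simplexA_comp_neg f g j ht.1]
  split_ifs <;> ring

theorem norm_simplexA_le {f g : ℝ → ℂ} {φ : ℝ → ℝ} (hf : LocallyIntegrable f volume)
    (hg : LocallyIntegrable g volume) (hφ : LocallyIntegrable φ volume)
    (hfφ : ∀ t, ‖f t‖ ≤ φ t) (hgφ : ∀ t, ‖g t‖ ≤ φ t) (j : ℕ) (x : ℝ) :
    ‖simplexA f g j x‖ ≤ |∫ t in (0 : ℝ)..x, φ t| ^ j / j.factorial := by
  have hφ0 : ∀ t, 0 ≤ φ t := fun t ↦ (norm_nonneg _).trans (hfφ t)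
  induction j generalizing x with
  | zero => simp [simplexA_zero]
  | succ j ih =>
    obtain ⟨c, hc, hsign⟩ : ∃ c : ℝ, |c| = 1 ∧ ∀ t ∈ Set.uIoc 0 x,
        |∫ u in (0 : ℝ)..t, φ u| = c * ∫ u in (0 : ℝ)..t, φ u := by
      rcases le_total 0 x with hx | hx
      · refine ⟨1, by simp, fun t ht ↦ ?_⟩
        rw [Set.uIoc_of_le hx] at ht
        rw [one_mul, abs_of_nonneg (integral_nonneg ht.1.le fun u _ ↦ hφ0 u)]
      · refine ⟨-1, by simp, fun t ht ↦ ?_⟩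
        rw [Set.uIoc_of_ge hx] at ht
        rw [neg_one_mul, abs_of_nonpos]
        rw [integral_symm, neg_nonpos]
        exact integral_nonneg ht.2 fun u _ ↦ hφ0 u
    have hc' := hφ.continuous_primitive 0
    have hb : LocallyIntegrable
        (fun t ↦ φ t * ((∫ u in (0 : ℝ)..t, φ u) ^ j / j.factorial)) volume :=
      hφ.mul_continuous (by fun_prop)
    rw [simplexA_succ hf hg]
    refine (norm_integral_le_abs_of_norm_le (g := fun t ↦ c ^ j *
      (φ t * ((∫ u in (0 : ℝ)..t, φ u) ^ j / j.factorial))) ?_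
      ((hb.intervalIntegrable' 0 x).const_mul _)).trans_eq ?_
    · refine (ae_restrict_iff' measurableSet_uIoc).2 (.of_forall fun t ht ↦ ?_)
      rw [norm_mul]
      have h1 : ‖if j % 2 = 0 then f t else g t‖ ≤ φ t := by
        split_ifs
        exacts [hfφ t, hgφ t]
      calc _ ≤ φ t * (|∫ u in (0 : ℝ)..t, φ u| ^ j / j.factorial) :=
            mul_le_mul h1 (ih t) (norm_nonneg _) (hφ0 t)
        _ = _ := by rw [hsign t ht, mul_pow]; ring
    · rw [intervalIntegral.integral_const_mul, integral_mul_primitive_pow hφ, abs_mul, abs_pow, hc,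
        one_pow, one_mul, abs_div, abs_pow, Nat.abs_cast]

theorem continuous_simplexA {f g : ℝ → ℂ} (hf : LocallyIntegrable f volume)
    (hg : LocallyIntegrable g volume) (j : ℕ) : Continuous (simplexA f g j) := by
  induction j with
  | zero =>
    rw [show simplexA f g 0 = fun _ ↦ 1 from funext (simplexA_zero f g)]
    exact continuous_const
  | succ j ih =>
    rw [show simplexA f g (j + 1) = _ from funext (simplexA_succ hf hg j)]
    by_cases hj : j % 2 = 0
    · simp only [hj, if_true]
      exact (hf.mul_continuous ih).continuous_primitive 0
    · simp only [hj, if_false]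
      exact (hg.mul_continuous ih).continuous_primitive 0

theorem exists_norm_simplexA_le {f g : ℝ → ℂ} (hf : LocallyIntegrable f volume)
    (hg : LocallyIntegrable g volume) {K : Set ℝ} (hK : IsCompact K) :
    ∃ M : ℝ, 0 ≤ M ∧ ∀ j, ∀ t ∈ K, ‖simplexA f g j t‖ ≤ M ^ j / j.factorial := by
  have hφ : LocallyIntegrable (fun t ↦ ‖f t‖ + ‖g t‖) volume :=
    (hf.mono hf.aestronglyMeasurable.norm (by simp)).add
      (hg.mono hg.aestronglyMeasurable.norm (by simp))
  obtain ⟨M, hM⟩ := hK.exists_bound_of_continuousOn (hφ.continuous_primitive 0).continuousOn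
  refine ⟨max M 0, le_max_right _ _, fun j t ht ↦
    (norm_simplexA_le hf hg hφ (fun t ↦ by simp) (fun t ↦ by simp) j t).trans ?_⟩
  gcongr
  exact (hM t ht).trans (le_max_left _ _)

theorem summable_simplexA {f g : ℝ → ℂ} (hf : LocallyIntegrable f volume)
    (hg : LocallyIntegrable g volume) {c : ℕ → ℂ} (hc : ∀ j, ‖c j‖ ≤ 1) (x : ℝ) :
    Summable fun j ↦ c j * simplexA f g j x := by
  obtain ⟨M, -, hM⟩ := exists_norm_simplexA_le hf hg (isCompact_singleton (x := x))
  refine .of_norm_bounded (Real.summable_pow_div_factorial M) fun j ↦ ?_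
  rw [norm_mul]
  exact (mul_le_of_le_one_left (norm_nonneg _) (hc j)).trans (hM j x rfl)

theorem continuous_tsum_simplexA {f g : ℝ → ℂ} (hf : LocallyIntegrable f volume)
    (hg : LocallyIntegrable g volume) {c : ℕ → ℂ} (hc : ∀ j, ‖c j‖ ≤ 1) :
    Continuous fun x ↦ ∑' j, c j * simplexA f g j x := by
  refine continuous_iff_continuousAt.2 fun x ↦ ?_
  obtain ⟨M, -, hM⟩ := exists_norm_simplexA_le hf hg (isCompact_closedBall x 1)
  refine (continuousOn_tsum (fun j ↦ ((continuous_simplexA hf hg j).const_mul _).continuousOn)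
    (Real.summable_pow_div_factorial M) fun j t ht ↦ ?_).continuousAt
    (Metric.closedBall_mem_nhds x one_pos)
  rw [norm_mul]
  exact (mul_le_of_le_one_left (norm_nonneg _) (hc j)).trans (hM j t ht)

theorem hasSum_integral_mul_simplexA {f g h : ℝ → ℂ} (hf : LocallyIntegrable f volume)
    (hg : LocallyIntegrable g volume) (hh : LocallyIntegrable h volume) {c : ℕ → ℂ}
    (hc : ∀ j, ‖c j‖ ≤ 1) (x : ℝ) :
    HasSum (fun j ↦ ∫ t in (0 : ℝ)..x, h t * (c j * simplexA f g j t))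
      (∫ t in (0 : ℝ)..x, h t * ∑' j, c j * simplexA f g j t) := by
  obtain ⟨M, -, hM⟩ := exists_norm_simplexA_le hf hg (isCompact_uIcc (a := (0 : ℝ)) (b := x))
  refine intervalIntegral.hasSum_integral_of_dominated_convergence
    (fun j t ↦ ‖h t‖ * (M ^ j / j.factorial)) (fun j ↦ ?_) (fun j ↦ .of_forall fun t ht ↦ ?_)
    (.of_forall fun t _ ↦ (Real.summable_pow_div_factorial M).mul_left _) ?_
    (.of_forall fun t _ ↦ (summable_simplexA hf hg hc t).hasSum.mul_left _)
  · exact (hh.mul_continuous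
      ((continuous_simplexA hf hg j).const_mul _)).aestronglyMeasurable.restrict
  · rw [norm_mul, norm_mul]
    gcongr
    exact (mul_le_of_le_one_left (norm_nonneg _) (hc j)).trans
      (hM j t (Set.uIoc_subset_uIcc ht))
  · simp_rw [tsum_mul_left]
    exact (hh.intervalIntegrable' 0 x).norm.mul_const _

theorem norm_one_add_neg_one_pow_div_two_le (j : ℕ) : ‖(1 + (-1 : ℂ) ^ j) / 2‖ ≤ 1 := by
  rcases neg_one_pow_eq_or ℂ j with h | h <;> rw [h] <;> norm_num

theorem norm_one_sub_neg_one_pow_div_two_le (j : ℕ) : ‖(1 - (-1 : ℂ) ^ j) / 2‖ ≤ 1 := by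
  rcases neg_one_pow_eq_or ℂ j with h | h <;> rw [h] <;> norm_num

theorem bivE_eq_tsum {f g : ℝ → ℂ} (hf : LocallyIntegrable f volume)
    (hg : LocallyIntegrable g volume) (x : ℝ) : bivE f g x = ∑' j, simplexA f g j x := by
  have := summable_simplexA hf hg (c := fun _ ↦ 1) (by simp) x
  simp only [one_mul] at this
  rw [this.tsum_eq_zero_add, simplexA_zero, bivE]

theorem bivC_eq_tsum {f g : ℝ → ℂ} (hf : LocallyIntegrable f volume)
    (hg : LocallyIntegrable g volume) (x : ℝ) :
    bivC f g x = ∑' j : ℕ, (1 + (-1 : ℂ) ^ j) / 2 * simplexA f g j x := by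
  have h1 := summable_simplexA hf hg (c := fun _ ↦ 1) (by simp) x
  have h2 := summable_simplexA hf hg (c := fun j ↦ (-1) ^ j) (by simp) x
  simp only [one_mul] at h1
  simp_rw [bivC, bivE_eq_tsum hf hg, bivE_eq_tsum hf.neg hg.neg, simplexA_neg]
  rw [← h1.tsum_add h2, ← tsum_div_const]
  congr 1
  funext j
  ring

theorem bivS_eq_tsum {f g : ℝ → ℂ} (hf : LocallyIntegrable f volume)
    (hg : LocallyIntegrable g volume) (x : ℝ) :
    bivS f g x = ∑' j : ℕ, (1 - (-1 : ℂ) ^ j) / 2 * simplexA f g j x := by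
  have h1 := summable_simplexA hf hg (c := fun _ ↦ 1) (by simp) x
  have h2 := summable_simplexA hf hg (c := fun j ↦ (-1) ^ j) (by simp) x
  simp only [one_mul] at h1
  simp_rw [bivS, bivE_eq_tsum hf hg, bivE_eq_tsum hf.neg hg.neg, simplexA_neg]
  rw [← h1.tsum_sub h2, ← tsum_div_const]
  congr 1
  funext j
  ring

theorem continuous_bivC {f g : ℝ → ℂ} (hf : LocallyIntegrable f volume)
    (hg : LocallyIntegrable g volume) : Continuous (bivC f g) := by
  rw [show bivC f g = _ from funext (bivC_eq_tsum hf hg)]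
  exact continuous_tsum_simplexA hf hg norm_one_add_neg_one_pow_div_two_le

theorem continuous_bivS {f g : ℝ → ℂ} (hf : LocallyIntegrable f volume)
    (hg : LocallyIntegrable g volume) : Continuous (bivS f g) := by
  rw [show bivS f g = _ from funext (bivS_eq_tsum hf hg)]
  exact continuous_tsum_simplexA hf hg norm_one_sub_neg_one_pow_div_two_le

theorem bivC_eq_one_add_integral {f g : ℝ → ℂ} (hf : LocallyIntegrable f volume)
    (hg : LocallyIntegrable g volume) (x : ℝ) :
    bivC f g x = 1 + ∫ t in (0 : ℝ)..x, g t * bivS f g t := by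
  simp_rw [bivS_eq_tsum hf hg]
  rw [← (hasSum_integral_mul_simplexA hf hg hg norm_one_sub_neg_one_pow_div_two_le x).tsum_eq,
    bivC_eq_tsum hf hg,
    (summable_simplexA hf hg norm_one_add_neg_one_pow_div_two_le x).tsum_eq_zero_add]
  congr 1
  · simp [simplexA_zero]
  congr 1
  funext j
  rw [simplexA_succ hf hg, ← intervalIntegral.integral_const_mul]
  congr 1
  funext t
  rcases Nat.even_or_odd j with hj | hj
  · simp [hj.neg_one_pow, pow_succ]
  · simp [hj.neg_one_pow, pow_succ, Nat.odd_iff.1 hj]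

theorem bivS_eq_integral {f g : ℝ → ℂ} (hf : LocallyIntegrable f volume)
    (hg : LocallyIntegrable g volume) (x : ℝ) :
    bivS f g x = ∫ t in (0 : ℝ)..x, f t * bivC f g t := by
  simp_rw [bivC_eq_tsum hf hg]
  rw [← (hasSum_integral_mul_simplexA hf hg hf norm_one_add_neg_one_pow_div_two_le x).tsum_eq,
    bivS_eq_tsum hf hg,
    (summable_simplexA hf hg norm_one_sub_neg_one_pow_div_two_le x).tsum_eq_zero_add]
  simp only [pow_zero, sub_self, zero_div, zero_mul, zero_add]
  congr 1
  funext j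
  rw [simplexA_succ hf hg, ← intervalIntegral.integral_const_mul]
  congr 1
  funext t
  rcases Nat.even_or_odd j with hj | hj
  · simp [hj.neg_one_pow, pow_succ, Nat.even_iff.1 hj]
  · simp [hj.neg_one_pow, pow_succ]

theorem linear_second_order_solution (α β : ℝ → ℂ)
    (hα : LocallyIntegrable α volume) (hβ : LocallyIntegrable β volume)
    (Pα : ℝ → ℂ) (hPα : Pα = fun x => ∫ t in (0:ℝ)..x, α t)
    (f g : ℝ → ℂ)
    (hf : f = fun x => -β x * Complex.exp (Pα x))
    (hg : g = fun x => Complex.exp (-Pα x))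
    (y₀ y₁ : ℂ) (y y' : ℝ → ℂ)
    (hy : y = fun x => y₀ * bivC f g x + y₁ * bivS g f x)
    (hy' : y' = fun x => g x * (y₀ * bivS f g x + y₁ * bivC g f x)) :
    LocAC y ∧ LocAC y' ∧
    (∀ᵐ x : ℝ, HasDerivAt y (y' x) x) ∧
    y 0 = y₀ ∧ y' 0 = y₁ ∧
    (∀ᵐ x : ℝ, ∃ D : ℂ, HasDerivAt y' D x ∧ D + α x * y' x + β x * y x = 0) := by
  have hPc : Continuous Pα := hPα ▸ hα.continuous_primitive 0
  have hgc : Continuous g := by rw [hg]; fun_prop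
  have hfL : LocallyIntegrable f volume := by
    rw [hf]
    exact hβ.neg.mul_continuous (by fun_prop)
  have hgL : LocallyIntegrable g volume := hgc.locallyIntegrable
  have hfg : ∀ x, g x * f x = -β x := fun x ↦ by
    rw [hf, hg]
    dsimp only
    rw [mul_left_comm, ← Complex.exp_add, neg_add_cancel, Complex.exp_zero, mul_one]
  have hg0 : g 0 = 1 := by simp [hg, hPα]
  set W : ℝ → ℂ := fun x ↦ y₀ * bivS f g x + y₁ * bivC g f x with hW
  have hy'W : ∀ x, y' x = g x * W x := fun x ↦ by rw [hy']
  have hyc : Continuous y := by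
    have := continuous_bivC hfL hgL
    have := continuous_bivS hgL hfL
    rw [hy]
    fun_prop
  have hWc : Continuous W := by
    have := continuous_bivS hfL hgL
    have := continuous_bivC hgL hfL
    fun_prop
  have hy'c : Continuous y' := by rw [hy']; exact hgc.mul hWc
  have hfyL : LocallyIntegrable (fun t ↦ f t * y t) volume := hfL.mul_continuous hyc
  have hy_eq : ∀ x, y x = y₀ + ∫ t in (0 : ℝ)..x, y' t := by
    intro x
    have h1 := (hgL.mul_continuous (continuous_bivS hfL hgL)).intervalIntegrable' 0 x
    have h2 := (hgL.mul_continuous (continuous_bivC hgL hfL)).intervalIntegrable' 0 x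
    have h3 : ∀ t, y' t = y₀ * (g t * bivS f g t) + y₁ * (g t * bivC g f t) := fun t ↦ by
      rw [hy'W]; ring
    simp_rw [h3]
    rw [intervalIntegral.integral_add (h1.const_mul _) (h2.const_mul _),
      intervalIntegral.integral_const_mul, intervalIntegral.integral_const_mul,
      ← bivS_eq_integral hgL hfL, hy]
    dsimp only
    rw [bivC_eq_one_add_integral hfL hgL]
    ring
  have hW_eq : W = fun x ↦ y₁ + ∫ t in (0 : ℝ)..x, f t * y t := by
    funext x
    have h1 := (hfL.mul_continuous (continuous_bivC hfL hgL)).intervalIntegrable' 0 x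
    have h2 := (hfL.mul_continuous (continuous_bivS hgL hfL)).intervalIntegrable' 0 x
    have h3 : ∀ t, f t * y t = y₀ * (f t * bivC f g t) + y₁ * (f t * bivS g f t) := fun t ↦ by
      rw [hy]; ring
    simp_rw [h3]
    rw [intervalIntegral.integral_add (h1.const_mul _) (h2.const_mul _),
      intervalIntegral.integral_const_mul, intervalIntegral.integral_const_mul,
      ← bivS_eq_integral hfL hgL, hW]
    dsimp only
    rw [bivC_eq_one_add_integral hgL hfL]
    ring
  have hy0 : y 0 = y₀ := by simp [hy_eq 0]
  have hgac : ∀ a b, AbsolutelyContinuousOnInterval g a b := fun a b ↦ by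
    rw [hg, hPα]
    exact (absolutelyContinuousOnInterval_primitive hα a b 0).comp_contDiff
      (φ := fun z ↦ Complex.exp (-z)) (by fun_prop)
  have hWac : ∀ a b, AbsolutelyContinuousOnInterval W a b := fun a b ↦ by
    rw [hW_eq]
    exact (absolutelyContinuousOnInterval_primitive hfyL a b 0).comp_contDiff
      (φ := fun z ↦ y₁ + z) (by fun_prop)
  have hderiv : ∀ᵐ x, HasDerivAt y' (-(α x * y' x + β x * y x)) x := by
    filter_upwards [LocallyIntegrable.ae_hasDerivAt_integral hα,
      LocallyIntegrable.ae_hasDerivAt_integral hfyL] with x h1 h2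
    have hP : HasDerivAt Pα (α x) x := hPα ▸ h1 0
    have hgd : HasDerivAt g (g x * -α x) x := by
      have := hP.neg.cexp
      rw [hg]
      exact this
    have hWd : HasDerivAt W (f x * y x) x := by
      rw [hW_eq]
      exact (h2 0).const_add y₁
    rw [hy']
    refine (hgd.mul hWd).congr_deriv ?_
    linear_combination y x * hfg x
  have hdL : LocallyIntegrable (fun x ↦ -(α x * y' x + β x * y x)) volume :=
    ((hα.mul_continuous hy'c).add (hβ.mul_continuous hyc)).neg
  refine ⟨⟨y', hy'c.locallyIntegrable, fun x ↦ by rw [hy0, hy_eq]⟩,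
    ⟨_, hdL, eq_add_integral_of_ae_hasDerivAt (fun a b ↦ ?_) hdL hderiv⟩, ?_, hy0, ?_, ?_⟩
  · rw [hy']
    exact (hgac a b).smul (hWac a b)
  · refine .of_forall fun x ↦ ?_
    rw [show y = fun x ↦ y₀ + ∫ t in (0 : ℝ)..x, y' t from funext hy_eq]
    exact (hy'c.integral_hasStrictDerivAt 0 x).hasDerivAt.const_add y₀
  · simp [hy'W, hg0, hW_eq]
  · filter_upwards [hderiv] with x hx
    exact ⟨_, hx, by ring⟩
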